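/- arXiv:2511.09393 — 2 statements merged into one kernel-verified Lean document; each statement's English description precedes it below -/
import Mathlib

section
/- Any biharmonic function on ℝⁿ with sublinear growth is constant: if u is smooth, Δ²u = 0, and |u(x)| ≤ B(1 + |x|^s) for some constants B > 0 and 0 ≤ s < 1, then u is constant. -/
open MeasureTheory

noncomputable def lap {n : ℕ} (u : EuclideanSpace ℝ (Fin n) → ℝ)
    (x : EuclideanSpace ℝ (Fin n)) : ℝ :=
  ∑ i : Fin n, fderiv ℝ (fun y => fderiv ℝ u y (EuclideanSpace.single i 1)) x
    (EuclideanSpace.single i 1)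

open Filter Topology

/-- The kernel `(1 - ‖y‖²)₊ ^ m`, supported in the closed unit ball. -/
noncomputable def radialBump {n : ℕ} (m : ℕ) (y : EuclideanSpace ℝ (Fin n)) : ℝ :=
  max (1 - ‖y‖ ^ 2) 0 ^ m

lemma hasDerivAt_max_zero_pow (m : ℕ) (t : ℝ) :
    HasDerivAt (fun t : ℝ => max t 0 ^ (m + 2)) ((m + 2) * max t 0 ^ (m + 1)) t := by
  rcases lt_trichotomy t 0 with ht | rfl | ht
  · have h : (fun t : ℝ => max t 0 ^ (m + 2)) =ᶠ[𝓝 t] fun _ => 0 := by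
      filter_upwards [Iio_mem_nhds ht] with r hr
      simp [max_eq_right (Set.mem_Iio.1 hr).le]
    simpa [max_eq_right ht.le] using (hasDerivAt_const t (0 : ℝ)).congr_of_eventuallyEq h
  · rw [hasDerivAt_iff_isLittleO]
    have h : (fun t : ℝ => max t 0 ^ (m + 2)) =O[𝓝 0] fun t : ℝ => t ^ (m + 2) := by
      refine Asymptotics.IsBigO.of_bound 1 (Eventually.of_forall fun r => ?_)
      rw [norm_pow, norm_pow, one_mul]
      gcongr
      rw [Real.norm_eq_abs, Real.norm_eq_abs, abs_of_nonneg (le_max_right r 0)]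
      exact max_le (le_abs_self r) (abs_nonneg r)
    have h' : (fun t : ℝ => t ^ (m + 2)) =o[𝓝 0] fun t : ℝ => t := by
      simpa using Asymptotics.isLittleO_pow_pow (𝕜 := ℝ) (show 1 < m + 2 by omega)
    simpa using h.trans_isLittleO h'
  · have h : (fun t : ℝ => max t 0 ^ (m + 2)) =ᶠ[𝓝 t] fun t => t ^ (m + 2) := by
      filter_upwards [Ioi_mem_nhds ht] with r hr
      simp [max_eq_left (Set.mem_Ioi.1 hr).le]
    simpa [max_eq_left ht.le] using (hasDerivAt_pow (m + 2) t).congr_of_eventuallyEq h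

section

variable {n : ℕ}

local notation "E" => EuclideanSpace ℝ (Fin n)

lemma radialBump_nonneg (m : ℕ) (y : E) : 0 ≤ radialBump m y :=
  pow_nonneg (le_max_right _ _) _

lemma continuous_radialBump (m : ℕ) : Continuous (radialBump m : E → ℝ) := by
  unfold radialBump
  fun_prop

lemma radialBump_eq_zero {m : ℕ} {y : E} (hy : 1 ≤ ‖y‖) : radialBump (m + 1) y = 0 := by
  rw [radialBump, max_eq_right (by nlinarith), zero_pow m.succ_ne_zero]

lemma hasCompactSupport_radialBump (m : ℕ) :
    HasCompactSupport (radialBump (m + 1) : E → ℝ) := by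
  refine HasCompactSupport.intro (isCompact_closedBall 0 1) fun y hy => radialBump_eq_zero ?_
  simpa using (not_le.1 (by simpa using hy : ¬ ‖y‖ ≤ 1)).le

lemma integral_radialBump_pos (m : ℕ) : 0 < ∫ y : E, radialBump (m + 1) y :=
  (continuous_radialBump _).integral_pos_of_hasCompactSupport_nonneg_nonzero
    (hasCompactSupport_radialBump m) (radialBump_nonneg _) (x := 0) (by simp [radialBump])

lemma hasFDerivAt_radialBump (m : ℕ) (y : E) :
    HasFDerivAt (radialBump (m + 2) : E → ℝ)
      ((-(2 * (m + 2)) * radialBump (m + 1) y) • innerSL ℝ y) y := by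
  have h := (hasDerivAt_max_zero_pow m (1 - ‖y‖ ^ 2)).comp_hasFDerivAt y
    ((hasStrictFDerivAt_norm_sq y).hasFDerivAt.const_sub 1)
  refine h.congr_fderiv ?_
  ext v
  simp [radialBump]
  ring

lemma integrable_mul_radialBump {f : E → ℝ} (hf : Continuous f) (m : ℕ) :
    Integrable fun y => f y * radialBump (m + 1) y :=
  (hf.mul (continuous_radialBump _)).integrable_of_hasCompactSupport
    (hasCompactSupport_radialBump m).mul_left

/-- Integration by parts against the kernels `radialBump`. -/
lemma mul_integral_fderiv_mul_radialBump {f : E → ℝ} (hf : ContDiff ℝ 1 f) (m : ℕ)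
    (x v : E) (R : ℝ) :
    R * ∫ y, fderiv ℝ f (x + R • y) v * radialBump (m + 2) y =
      2 * (m + 2) * ∫ y, f (x + R • y) * inner ℝ y v * radialBump (m + 1) y := by
  have hd (y : E) : HasFDerivAt (fun y => f (x + R • y)) (R • fderiv ℝ f (x + R • y)) y := by
    have h := (hf.differentiable one_ne_zero (x + R • y)).hasFDerivAt.comp y
      (((hasFDerivAt_id y).const_smul R).const_add x)
    refine h.congr_fderiv ?_
    ext v
    simp
  have hc : Continuous f := hf.continuous
  have hc' : Continuous (fderiv ℝ f) := hf.continuous_fderiv one_ne_zero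
  have key := integral_mul_fderiv_eq_neg_fderiv_mul_of_integrable (μ := volume) (v := v)
    (f := fun y : E => f (x + R • y)) (g := radialBump (m + 2)) ?_ ?_ ?_
    (fun y _ => (hd y).differentiableAt)
    (fun y _ => (hasFDerivAt_radialBump m y).differentiableAt)
  · simp only [(hd _).fderiv, (hasFDerivAt_radialBump m _).fderiv] at key
    rw [← integral_const_mul, ← integral_const_mul, ← neg_inj, ← integral_neg, ← integral_neg]
    rw [← integral_neg] at key
    convert key.symm using 2 <;> ext y <;> simp <;> ring
  · simp only [(hd _).fderiv]
    exact integrable_mul_radialBump (by fun_prop) (m + 1)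
  · simp only [(hasFDerivAt_radialBump m _).fderiv]
    convert integrable_mul_radialBump (n := n)
      (f := fun y => f (x + R • y) * (-(2 * (m + 2)) * inner ℝ y v)) (by fun_prop) m using 2
    simp
    ring
  · exact integrable_mul_radialBump (by fun_prop) (m + 1)

lemma contDiff_fderiv_apply {f : E → ℝ} (hf : ContDiff ℝ (⊤ : ℕ∞) f) (v : E) :
    ContDiff ℝ (⊤ : ℕ∞) fun y => fderiv ℝ f y v :=
  (hf.fderiv_right (m := (⊤ : ℕ∞)) (by simp)).clm_apply contDiff_const

lemma contDiff_lap {f : E → ℝ} (hf : ContDiff ℝ (⊤ : ℕ∞) f) :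
    ContDiff ℝ (⊤ : ℕ∞) (lap f) :=
  ContDiff.sum fun _ _ => contDiff_fderiv_apply (contDiff_fderiv_apply hf _) _

lemma fderiv_fderiv_apply_comm {f : E → ℝ} (hf : ContDiff ℝ (⊤ : ℕ∞) f) (v w x : E) :
    fderiv ℝ (fun y => fderiv ℝ f y v) x w = fderiv ℝ (fun y => fderiv ℝ f y w) x v := by
  have hd : DifferentiableAt ℝ (fderiv ℝ f) x :=
    (hf.fderiv_right (m := 1) (by norm_cast)).differentiable one_ne_zero x
  have hs : IsSymmSndFDerivAt ℝ f x :=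
    hf.contDiffAt.isSymmSndFDerivAt (by simp; norm_cast)
  rw [fderiv_clm_apply hd (differentiableAt_const v),
    fderiv_clm_apply hd (differentiableAt_const w)]
  simpa using hs w v

lemma lap_fderiv_apply {f : E → ℝ} (hf : ContDiff ℝ (⊤ : ℕ∞) f) (v : E) :
    lap (fun y => fderiv ℝ f y v) = fun x => fderiv ℝ (lap f) x v := by
  ext x
  have hd (i : Fin n) := contDiff_fderiv_apply
    (contDiff_fderiv_apply hf (EuclideanSpace.single i 1)) (EuclideanSpace.single i 1)
  unfold lap
  rw [fderiv_fun_sum fun i _ => (hd i).differentiable (by simp) x, sum_apply]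
  refine Finset.sum_congr rfl fun i _ => ?_
  simp_rw [fderiv_fderiv_apply_comm hf v]
  exact fderiv_fderiv_apply_comm (contDiff_fderiv_apply hf _) _ _ _

lemma hasDerivAt_integral_mul_radialBump {w : E → ℝ} (hw : ContDiff ℝ (⊤ : ℕ∞) w) (m : ℕ)
    (x : E) (R : ℝ) :
    HasDerivAt (fun R : ℝ => ∫ y, w (x + R • y) * radialBump (m + 1) y)
      (R / (2 * (m + 2)) * ∫ y, lap w (x + R • y) * radialBump (m + 2) y) R := by
  have hc : Continuous w := hw.continuous
  have hc' : Continuous (fderiv ℝ w) := hw.continuous_fderiv (by simp)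
  obtain ⟨C, hC⟩ := (isCompact_closedBall x (|R| + 1)).exists_bound_of_continuousOn
    hc'.continuousOn
  have h := (hasDerivAt_integral_of_dominated_loc_of_deriv_le (μ := volume)
    (F := fun (R : ℝ) (y : E) => w (x + R • y) * radialBump (m + 1) y)
    (F' := fun (R : ℝ) (y : E) => fderiv ℝ w (x + R • y) y * radialBump (m + 1) y)
    (bound := fun y => C * radialBump (m + 1) y)
    (Metric.ball_mem_nhds R one_pos)
    (Eventually.of_forall fun r => (integrable_mul_radialBump
      (by fun_prop) m).aestronglyMeasurable)
    (integrable_mul_radialBump (by fun_prop) m)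
    (integrable_mul_radialBump (by fun_prop) m).aestronglyMeasurable
    (Eventually.of_forall fun y r hr => ?_)
    (integrable_mul_radialBump continuous_const m)
    (Eventually.of_forall fun y r _ => ?_)).2
  · refine h.congr_deriv ?_
    have hsum (y : E) : fderiv ℝ w (x + R • y) y * radialBump (m + 1) y =
        ∑ i : Fin n, fderiv ℝ w (x + R • y) (EuclideanSpace.single i 1) *
          inner ℝ y (EuclideanSpace.single i (1 : ℝ)) * radialBump (m + 1) y := by
      rw [← Finset.sum_mul]
      congr 1
      conv_lhs => enter [2]; rw [← (EuclideanSpace.basisFun (Fin n) ℝ).sum_repr y]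
      simp [map_sum, EuclideanSpace.inner_single_right, mul_comm]
    have hdc (i : Fin n) : Continuous fun y => fderiv ℝ w y (EuclideanSpace.single i 1) :=
      (contDiff_fderiv_apply hw _).continuous
    simp_rw [hsum, lap, Finset.sum_mul]
    rw [integral_finsetSum, integral_finsetSum, Finset.mul_sum]
    · refine Finset.sum_congr rfl fun i _ => ?_
      have := mul_integral_fderiv_mul_radialBump
        ((contDiff_fderiv_apply hw (EuclideanSpace.single i 1)).of_le (by norm_cast))
        m x (EuclideanSpace.single i 1) R
      rw [div_mul_eq_mul_div, this, mul_div_cancel_left₀ _ (by positivity)]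
    · intro i _
      have := (contDiff_fderiv_apply (contDiff_fderiv_apply hw (EuclideanSpace.single i 1))
        (EuclideanSpace.single i 1)).continuous
      exact integrable_mul_radialBump (by fun_prop) (m + 1)
    · intro i _
      exact integrable_mul_radialBump (((hdc i).comp (by fun_prop)).mul (by fun_prop)) m
  · rw [norm_mul, Real.norm_of_nonneg (radialBump_nonneg _ _)]
    rcases le_or_gt 1 ‖y‖ with hy | hy
    · simp [radialBump_eq_zero hy]
    refine mul_le_mul_of_nonneg_right ?_ (radialBump_nonneg _ _)
    have hr' : |r| ≤ |R| + 1 := by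
      have := abs_sub_abs_le_abs_sub r R
      have := (Real.dist_eq r R).symm.trans_lt hr
      linarith
    have hC' := hC (x + r • y) (by
      rw [mem_closedBall_iff_norm, add_sub_cancel_left, norm_smul, Real.norm_eq_abs]
      nlinarith [abs_nonneg r])
    calc ‖fderiv ℝ w (x + r • y) y‖ ≤ ‖fderiv ℝ w (x + r • y)‖ * ‖y‖ :=
          ContinuousLinearMap.le_opNorm _ _
      _ ≤ ‖fderiv ℝ w (x + r • y)‖ * 1 := by gcongr
      _ ≤ C := by rwa [mul_one]
  · have h := (hw.differentiable (by simp) (x + r • y)).hasFDerivAt.comp_hasDerivAt r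
      (((hasDerivAt_id r).smul_const y).const_add x)
    simpa using h.mul_const (radialBump (m + 1) y)

lemma integral_harmonic_mul_radialBump {v : E → ℝ} (hv : ContDiff ℝ (⊤ : ℕ∞) v)
    (hlap : ∀ x, lap v x = 0) (m : ℕ) (x : E) (R : ℝ) :
    ∫ y, v (x + R • y) * radialBump (m + 1) y = v x * ∫ y : E, radialBump (m + 1) y := by
  have hd := hasDerivAt_integral_mul_radialBump hv m x
  simp only [hlap, zero_mul, integral_zero, mul_zero] at hd
  rw [is_const_of_deriv_eq_zero (fun r => (hd r).differentiableAt) (fun r => (hd r).deriv) R 0]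
  simp [integral_const_mul]

/-- Radially weighted means of a biharmonic function are quadratic in the radius. -/
lemma integral_biharmonic_mul_radialBump {w : E → ℝ} (hw : ContDiff ℝ (⊤ : ℕ∞) w)
    (hlap : ∀ x, lap (lap w) x = 0) (m : ℕ) (x : E) :
    ∃ b : ℝ, ∀ R : ℝ, ∫ y, w (x + R • y) * radialBump (m + 1) y =
      w x * (∫ y : E, radialBump (m + 1) y) + b * R ^ 2 := by
  have hd := hasDerivAt_integral_mul_radialBump hw m x
  simp only [integral_harmonic_mul_radialBump (contDiff_lap hw) hlap] at hd
  set c : ℝ := lap w x * ∫ y : E, radialBump (m + 1 + 1) y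
  refine ⟨c / (4 * (m + 2)), fun R => ?_⟩
  have hq (r : ℝ) : HasDerivAt (fun r : ℝ => (∫ y, w (x + r • y) * radialBump (m + 1) y) -
      c / (4 * (m + 2)) * r ^ 2) 0 r := by
    refine ((hd r).sub ((hasDerivAt_pow 2 r).const_mul _)).congr_deriv ?_
    field_simp
    ring
  have := is_const_of_deriv_eq_zero (fun r => (hq r).differentiableAt)
    (fun r => (hq r).deriv) R 0
  simp only [zero_smul, add_zero, integral_const_mul] at this
  linarith

lemma eq_zero_of_tendsto_add_mul_sq {a b : ℝ}
    (h : Tendsto (fun R : ℝ => a + b * R ^ 2) atTop (𝓝 0)) : a = 0 := by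
  have h2 := h.comp (tendsto_id.const_mul_atTop (two_pos : (0 : ℝ) < 2))
  have h3 := (h.const_mul 4).sub h2
  have : (fun R : ℝ => 4 * (a + b * R ^ 2) - ((fun R : ℝ => a + b * R ^ 2) ∘
      fun R : ℝ => 2 * id R) R) = fun _ => 3 * a := by
    ext R
    simp
    ring
  rw [this] at h3
  have := tendsto_nhds_unique h3 tendsto_const_nhds
  linarith

lemma tendsto_integral_fderiv_mul_radialBump {u : E → ℝ} (hu : ContDiff ℝ 1 u)
    {B s : ℝ} (hB : 0 ≤ B) (hs0 : 0 ≤ s) (hs1 : s < 1)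
    (hgrow : ∀ x, |u x| ≤ B * (1 + ‖x‖ ^ s)) (x v : E) :
    Tendsto (fun R : ℝ => ∫ y, fderiv ℝ u (x + R • y) v * radialBump 2 y) atTop (𝓝 0) := by
  set J : ℝ := ∫ y : E, radialBump 1 y
  have hlim : Tendsto (fun R : ℝ => 4 * (B * (1 + (‖x‖ + 1) ^ s) * ‖v‖ * J) * R ^ (-(1 - s)))
      atTop (𝓝 0) := by
    simpa using (tendsto_rpow_neg_atTop (sub_pos.2 hs1)).const_mul
      (4 * (B * (1 + (‖x‖ + 1) ^ s) * ‖v‖ * J))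
  refine squeeze_zero_norm' ?_ hlim
  filter_upwards [eventually_ge_atTop 1] with R hR
  have hR0 : 0 < R := one_pos.trans_le hR
  have hpt (y : E) : ‖u (x + R • y) * inner ℝ y v * radialBump 1 y‖ ≤
      B * (1 + (‖x‖ + 1) ^ s) * ‖v‖ * R ^ s * radialBump 1 y := by
    rw [norm_mul, Real.norm_of_nonneg (radialBump_nonneg 1 y)]
    rcases le_or_gt 1 ‖y‖ with hy | hy
    · simp [radialBump_eq_zero (m := 0) hy]
    refine mul_le_mul_of_nonneg_right ?_ (radialBump_nonneg _ _)
    have h1 : ‖x + R • y‖ ≤ (‖x‖ + 1) * R := by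
      calc ‖x + R • y‖ ≤ ‖x‖ + R * ‖y‖ := by
            simpa [norm_smul, abs_of_pos hR0] using norm_add_le x (R • y)
        _ ≤ (‖x‖ + 1) * R := by nlinarith [norm_nonneg x]
    have h2 : |u (x + R • y)| ≤ B * ((1 + (‖x‖ + 1) ^ s) * R ^ s) := by
      refine (hgrow _).trans (mul_le_mul_of_nonneg_left ?_ hB)
      have h3 := Real.rpow_le_rpow (norm_nonneg _) h1 hs0
      rw [Real.mul_rpow (by positivity) hR0.le] at h3
      linarith [Real.one_le_rpow hR hs0]
    have h4 : |inner ℝ y v| ≤ ‖v‖ :=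
      (abs_real_inner_le_norm y v).trans (mul_le_of_le_one_left (norm_nonneg v) hy.le)
    rw [norm_mul, Real.norm_eq_abs, Real.norm_eq_abs]
    calc _ ≤ B * ((1 + (‖x‖ + 1) ^ s) * R ^ s) * ‖v‖ := by gcongr
      _ = _ := by ring
  have hint := norm_integral_le_of_norm_le
    (integrable_mul_radialBump continuous_const 0) (Eventually.of_forall hpt)
  rw [integral_const_mul] at hint
  have hparts := mul_integral_fderiv_mul_radialBump hu 0 x v R
  simp only [Nat.cast_zero, zero_add] at hparts
  have hfd : ∫ y, fderiv ℝ u (x + R • y) v * radialBump 2 y =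
      4 * (∫ y, u (x + R • y) * inner ℝ y v * radialBump 1 y) / R := by
    rw [eq_div_iff hR0.ne']
    linarith
  have hpow : R ^ (-(1 - s)) = R ^ s / R := by
    rw [neg_sub, Real.rpow_sub_one hR0.ne']
  rw [hfd, hpow, norm_div, norm_mul, Real.norm_of_nonneg hR0.le, mul_div_assoc', Real.norm_ofNat]
  refine div_le_div_of_nonneg_right ?_ hR0.le
  calc _ ≤ 4 * (B * (1 + (‖x‖ + 1) ^ s) * ‖v‖ * R ^ s * J) := by gcongr
    _ = _ := by ring

end

/-- A biharmonic function on ℝⁿ with sublinear growth is constant. -/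
theorem biharmonic_sublinear_constant {n : ℕ} (u : EuclideanSpace ℝ (Fin n) → ℝ)
    (hu : ContDiff ℝ (⊤ : ℕ∞) u) (hbih : ∀ x, lap (lap u) x = 0)
    (B s : ℝ) (hB : 0 < B) (hs0 : 0 ≤ s) (hs1 : s < 1)
    (hgrow : ∀ x, |u x| ≤ B * (1 + ‖x‖ ^ s)) :
    ∀ x y, u x = u y := by
  refine is_const_of_fderiv_eq_zero (𝕜 := ℝ) (hu.differentiable (by simp)) fun x => ?_
  ext v
  have hbih' (z : EuclideanSpace ℝ (Fin n)) : lap (lap fun y => fderiv ℝ u y v) z = 0 := by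
    rw [lap_fderiv_apply hu, lap_fderiv_apply (contDiff_lap hu), funext hbih]
    simp
  obtain ⟨b, hb⟩ := integral_biharmonic_mul_radialBump (contDiff_fderiv_apply hu v) hbih' 1 x
  have hlim := tendsto_integral_fderiv_mul_radialBump (hu.of_le (by norm_cast)) hB.le hs0 hs1
    hgrow x v
  simp only [Nat.reduceAdd] at hb
  simp only [hb] at hlim
  exact (mul_eq_zero.1 (eq_zero_of_tendsto_add_mul_sq hlim)).resolve_right
    (integral_radialBump_pos 1).ne'
end

section
/- If u is biharmonic on ℝⁿ and has polynomial growth of rate d, then the harmonic function f = Δu satisfies ∫_{B_r(0)} f² dx ≤ C(1 + r^{2d+n-2}) for all r > R₀, with constants C, R₀ depending only on n, d, and the growth constant of u. -/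
open MeasureTheory

/-- The partial derivative of `g` in the `i`-th coordinate direction. -/
noncomputable def pderiv {n : ℕ} (i : Fin n) (g : EuclideanSpace ℝ (Fin n) → ℝ)
    (x : EuclideanSpace ℝ (Fin n)) : ℝ :=
  fderiv ℝ g x (EuclideanSpace.single i 1)

section Calculus

variable {n : ℕ} {g h : EuclideanSpace ℝ (Fin n) → ℝ}

lemma lap_eq_sum_pderiv (g : EuclideanSpace ℝ (Fin n) → ℝ) (x : EuclideanSpace ℝ (Fin n)) :
    lap g x = ∑ i, pderiv i (pderiv i g) x := rfl

lemma contDiff_pderiv (hg : ContDiff ℝ (⊤ : ℕ∞) g) (i : Fin n) :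
    ContDiff ℝ (⊤ : ℕ∞) (pderiv i g) :=
  (hg.fderiv_right (m := (⊤ : ℕ∞)) (by simp)).clm_apply contDiff_const

lemma contDiff_lap_s11 (hg : ContDiff ℝ (⊤ : ℕ∞) g) : ContDiff ℝ (⊤ : ℕ∞) (lap g) :=
  ContDiff.sum fun i _ => contDiff_pderiv (contDiff_pderiv hg i) i

lemma differentiableAt_of_smooth (hg : ContDiff ℝ (⊤ : ℕ∞) g) (x : EuclideanSpace ℝ (Fin n)) :
    DifferentiableAt ℝ g x :=
  (hg.differentiable (by simp)).differentiableAt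

lemma pderiv_mul (hg : ContDiff ℝ (⊤ : ℕ∞) g) (hh : ContDiff ℝ (⊤ : ℕ∞) h) (i : Fin n) :
    pderiv i (fun x => g x * h x) = fun x => g x * pderiv i h x + h x * pderiv i g x := by
  funext x
  simp [pderiv, fderiv_fun_mul (differentiableAt_of_smooth hg x)
    (differentiableAt_of_smooth hh x)]

lemma pderiv_add (hg : ContDiff ℝ (⊤ : ℕ∞) g) (hh : ContDiff ℝ (⊤ : ℕ∞) h) (i : Fin n) :
    pderiv i (fun x => g x + h x) = fun x => pderiv i g x + pderiv i h x := by
  funext x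
  simp [pderiv, fderiv_fun_add (differentiableAt_of_smooth hg x)
    (differentiableAt_of_smooth hh x)]

lemma pderiv_pow (hg : ContDiff ℝ (⊤ : ℕ∞) g) (k : ℕ) (i : Fin n) :
    pderiv i (fun x => g x ^ (k + 1)) = fun x => (k + 1) * g x ^ k * pderiv i g x := by
  funext x
  simp [pderiv, fderiv_fun_pow (k + 1) (differentiableAt_of_smooth hg x)]

lemma lap_mul (hg : ContDiff ℝ (⊤ : ℕ∞) g) (hh : ContDiff ℝ (⊤ : ℕ∞) h)
    (x : EuclideanSpace ℝ (Fin n)) :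
    lap (fun x => g x * h x) x
      = h x * lap g x + 2 * ∑ i, pderiv i g x * pderiv i h x + g x * lap h x := by
  simp only [lap_eq_sum_pderiv, Finset.mul_sum, ← Finset.sum_add_distrib]
  refine Finset.sum_congr rfl fun i _ => ?_
  have hg' := contDiff_pderiv hg i
  have hh' := contDiff_pderiv hh i
  rw [pderiv_mul hg hh, pderiv_add (hg.mul hh') (hh.mul hg'), pderiv_mul hg hh',
    pderiv_mul hh hg']
  ring

lemma lap_pow (hg : ContDiff ℝ (⊤ : ℕ∞) g) (k : ℕ) (x : EuclideanSpace ℝ (Fin n)) :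
    lap (fun x => g x ^ (k + 2)) x
      = ∑ i, ((k + 2) * (k + 1) * g x ^ k * pderiv i g x ^ 2
          + (k + 2) * g x ^ (k + 1) * pderiv i (pderiv i g) x) := by
  rw [lap_eq_sum_pderiv]
  refine Finset.sum_congr rfl fun i _ => ?_
  have hc : ContDiff ℝ (⊤ : ℕ∞)
      fun _ : EuclideanSpace ℝ (Fin n) => ((k + 1 : ℕ) + 1 : ℝ) := contDiff_const
  rw [pderiv_pow hg (k + 1), pderiv_mul (hc.mul (hg.pow (k + 1))) (contDiff_pderiv hg i),
    pderiv_mul hc (hg.pow (k + 1)), pderiv_pow hg k]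
  simp only [pderiv, fderiv_fun_const]
  push_cast
  simp
  ring

/-- Second-order integration by parts against a compactly supported function. -/
lemma integral_mul_lap_eq (hg : ContDiff ℝ (⊤ : ℕ∞) g) (hh : ContDiff ℝ (⊤ : ℕ∞) h)
    (hc : HasCompactSupport g) : ∫ x, g x * lap h x = ∫ x, h x * lap g x := by
  have key : ∀ {a b : EuclideanSpace ℝ (Fin n) → ℝ}, ContDiff ℝ (⊤ : ℕ∞) a →
      ContDiff ℝ (⊤ : ℕ∞) b → HasCompactSupport a → Integrable fun x => a x * b x :=
    fun ha hb hac => (ha.continuous.mul hb.continuous).integrable_of_hasCompactSupport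
      hac.mul_right
  have hcp : ∀ {a : EuclideanSpace ℝ (Fin n) → ℝ} (i : Fin n), HasCompactSupport a →
      HasCompactSupport (pderiv i a) := fun i ha => ha.fderiv_apply (𝕜 := ℝ) _
  have ibp : ∀ {a b : EuclideanSpace ℝ (Fin n) → ℝ}, ContDiff ℝ (⊤ : ℕ∞) a →
      ContDiff ℝ (⊤ : ℕ∞) b → HasCompactSupport a → ∀ i : Fin n,
      ∫ x, a x * pderiv i b x = - ∫ x, pderiv i a x * b x := fun ha hb hac i =>
    integral_mul_fderiv_eq_neg_fderiv_mul_of_integrable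
      (key (contDiff_pderiv ha i) hb (hcp i hac)) (key ha (contDiff_pderiv hb i) hac)
      (key ha hb hac) (fun x _ => differentiableAt_of_smooth ha x)
      (fun x _ => differentiableAt_of_smooth hb x)
  simp only [lap_eq_sum_pderiv, Finset.mul_sum]
  rw [integral_finsetSum _ fun i _ => key hg (contDiff_pderiv (contDiff_pderiv hh i) i) hc,
    integral_finsetSum _ fun i _ => by
      simpa only [mul_comm] using
        key (contDiff_pderiv (contDiff_pderiv hg i) i) hh (hcp i (hcp i hc))]
  refine Finset.sum_congr rfl fun i _ => ?_
  rw [ibp hg (contDiff_pderiv hh i) hc i, ibp (contDiff_pderiv hg i) hh (hcp i hc) i, neg_neg]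
  simp only [mul_comm]

lemma pderiv_comp_smul (hg : ContDiff ℝ (⊤ : ℕ∞) g) (c : ℝ) (i : Fin n) :
    pderiv i (fun x => g (c • x)) = fun x => c * pderiv i g (c • x) := by
  funext x
  have h1 : HasFDerivAt (fun x : EuclideanSpace ℝ (Fin n) => c • x)
      (c • ContinuousLinearMap.id ℝ (EuclideanSpace ℝ (Fin n))) x :=
    (hasFDerivAt_id x).const_smul c
  have h2 := (differentiableAt_of_smooth hg (c • x)).hasFDerivAt.comp x h1
  have h3 : fderiv ℝ (fun x => g (c • x)) x = _ := h2.fderiv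
  simp [pderiv, h3]

end Calculus

/-- Smooth cutoffs between the balls of radii `r` and `2 * r`, with the scale-invariant bounds on
the first and second derivatives. -/
lemma exists_scaled_cutoff (n : ℕ) :
    ∃ K : ℝ, 0 ≤ K ∧ ∀ r : ℝ, 0 < r → ∃ η : EuclideanSpace ℝ (Fin n) → ℝ,
      ContDiff ℝ (⊤ : ℕ∞) η ∧ (∀ x, 0 ≤ η x) ∧ (∀ x, η x ≤ 1) ∧
      (∀ x ∈ Metric.ball 0 r, η x = 1) ∧ (∀ x ∉ Metric.closedBall 0 (2 * r), η x = 0) ∧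
      (∀ i x, |pderiv i η x| ≤ K / r) ∧ (∀ i x, |pderiv i (pderiv i η) x| ≤ K / r ^ 2) := by
  let φ : ContDiffBump (0 : EuclideanSpace ℝ (Fin n)) := ⟨1, 2, one_pos, one_lt_two⟩
  have hφ : ContDiff ℝ (⊤ : ℕ∞) φ := φ.contDiff
  have hφc : HasCompactSupport φ := φ.hasCompactSupport
  have b1 : ∀ i : Fin n, ∃ C, ∀ x, ‖pderiv i φ x‖ ≤ C := fun i =>
    HasCompactSupport.exists_bound_of_continuous (hφc.fderiv_apply (𝕜 := ℝ) _)
      (contDiff_pderiv hφ i).continuous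
  have b2 : ∀ i : Fin n, ∃ C, ∀ x, ‖pderiv i (pderiv i φ) x‖ ≤ C := fun i =>
    HasCompactSupport.exists_bound_of_continuous
      (HasCompactSupport.fderiv_apply (𝕜 := ℝ) (hφc.fderiv_apply (𝕜 := ℝ) _) _)
      (contDiff_pderiv (contDiff_pderiv hφ i) i).continuous
  choose C₁ hC₁ using b1
  choose C₂ hC₂ using b2
  have le1 : ∀ i, C₁ i ≤ ∑ j, (|C₁ j| + |C₂ j|) := fun i => by
    have := Finset.single_le_sum (f := fun j => |C₁ j| + |C₂ j|)
      (fun j _ => by positivity) (Finset.mem_univ i)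
    linarith [le_abs_self (C₁ i), abs_nonneg (C₂ i)]
  have le2 : ∀ i, C₂ i ≤ ∑ j, (|C₁ j| + |C₂ j|) := fun i => by
    have := Finset.single_le_sum (f := fun j => |C₁ j| + |C₂ j|)
      (fun j _ => by positivity) (Finset.mem_univ i)
    linarith [le_abs_self (C₂ i), abs_nonneg (C₁ i)]
  refine ⟨∑ j, (|C₁ j| + |C₂ j|), Finset.sum_nonneg fun j _ => by positivity, fun r hr => ?_⟩
  have hnorm : ∀ x : EuclideanSpace ℝ (Fin n), ‖r⁻¹ • x‖ = ‖x‖ / r := fun x => by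
    rw [norm_smul, Real.norm_of_nonneg (by positivity)]; ring
  refine ⟨fun x => φ (r⁻¹ • x), hφ.comp (contDiff_const_smul _), fun x => φ.nonneg,
    fun x => φ.le_one, fun x hx => φ.one_of_mem_closedBall ?_, fun x hx => ?_, fun i x => ?_,
    fun i x => ?_⟩
  · rw [mem_closedBall_zero_iff, hnorm]
    rw [mem_ball_zero_iff] at hx
    exact (div_le_one hr).2 hx.le
  · refine φ.zero_of_le_dist ?_
    rw [mem_closedBall_zero_iff, not_le] at hx
    rw [dist_zero_right, hnorm]
    exact (le_div_iff₀ hr).2 hx.le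
  · rw [pderiv_comp_smul hφ, abs_mul, abs_of_pos (inv_pos.2 hr), div_eq_inv_mul]
    gcongr
    exact (hC₁ i _).trans (le1 i)
  · have hc : ContDiff ℝ (⊤ : ℕ∞) fun _ : EuclideanSpace ℝ (Fin n) => r⁻¹ := contDiff_const
    have hd : ContDiff ℝ (⊤ : ℕ∞) fun x => pderiv i φ (r⁻¹ • x) :=
      (contDiff_pderiv hφ i).comp (contDiff_const_smul _)
    rw [pderiv_comp_smul hφ, pderiv_mul hc hd, pderiv_comp_smul (contDiff_pderiv hφ i)]
    have h0 : pderiv i (fun _ : EuclideanSpace ℝ (Fin n) => r⁻¹) x = 0 := by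
      simp [pderiv]
    simp only [h0, mul_zero, add_zero]
    rw [← mul_assoc, abs_mul, abs_of_pos (by positivity), div_eq_inv_mul,
      show (r ^ 2)⁻¹ = r⁻¹ * r⁻¹ by rw [sq, mul_inv]]
    gcongr
    exact (hC₂ i _).trans (le2 i)

/-- The Laplacian of a power of a cutoff with derivatives of size `K / r` and `K / r ^ 2`. -/
lemma abs_lap_pow_le {n : ℕ} {η : EuclideanSpace ℝ (Fin n) → ℝ} {r K : ℝ}
    (hη : ContDiff ℝ (⊤ : ℕ∞) η) (h0 : ∀ x, 0 ≤ η x) (h1 : ∀ x, η x ≤ 1)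
    (hd1 : ∀ i x, |pderiv i η x| ≤ K / r) (hd2 : ∀ i x, |pderiv i (pderiv i η) x| ≤ K / r ^ 2)
    (k : ℕ) (x : EuclideanSpace ℝ (Fin n)) :
    |lap (fun x => η x ^ (k + 2)) x|
      ≤ n * ((k + 2) * (k + 1) * K ^ 2 + (k + 2) * K) / r ^ 2 * η x ^ k := by
  rw [lap_pow hη]
  refine (Finset.abs_sum_le_sum_abs _ _).trans ?_
  have : ∀ i : Fin n, |(k + 2) * (k + 1) * η x ^ k * pderiv i η x ^ 2
      + (k + 2) * η x ^ (k + 1) * pderiv i (pderiv i η) x|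
      ≤ ((k + 2) * (k + 1) * K ^ 2 + (k + 2) * K) / r ^ 2 * η x ^ k := by
    intro i
    have hx := h0 x
    have e1 : pderiv i η x ^ 2 ≤ K ^ 2 / r ^ 2 := by
      rw [← sq_abs, ← div_pow]
      exact pow_le_pow_left₀ (abs_nonneg _) (hd1 i x) 2
    have e2 := hd2 i x
    have e3 : η x ^ (k + 1) ≤ η x ^ k := pow_le_pow_of_le_one hx (h1 x) (Nat.le_succ k)
    calc _ ≤ |(k + 2) * (k + 1) * η x ^ k * pderiv i η x ^ 2|
          + |(k + 2) * η x ^ (k + 1) * pderiv i (pderiv i η) x| := abs_add_le _ _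
      _ = (k + 2) * (k + 1) * η x ^ k * pderiv i η x ^ 2
          + (k + 2) * η x ^ (k + 1) * |pderiv i (pderiv i η) x| := by
        rw [abs_of_nonneg (by positivity), abs_mul, abs_of_nonneg (by positivity)]
      _ ≤ (k + 2) * (k + 1) * η x ^ k * (K ^ 2 / r ^ 2)
          + (k + 2) * η x ^ k * (K / r ^ 2) := by gcongr
      _ = _ := by ring
  refine (Finset.sum_le_sum fun i _ => this i).trans (le_of_eq ?_)
  simp
  ring

/-- Interior estimate: the `L²` norm of the Laplacian of a biharmonic function is controlled by
the supremum of the function on a larger ball. -/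
lemma integral_cutoff_mul_sq_lap_le {n : ℕ} {u η : EuclideanSpace ℝ (Fin n) → ℝ} {r K S : ℝ}
    (hu : ContDiff ℝ (⊤ : ℕ∞) u) (hbi : ∀ x, lap (lap u) x = 0) (hr : 0 < r) (hK : 0 ≤ K)
    (hS : ∀ x ∈ Metric.closedBall 0 (2 * r), |u x| ≤ S)
    (hη : ContDiff ℝ (⊤ : ℕ∞) η) (h0 : ∀ x, 0 ≤ η x) (h1 : ∀ x, η x ≤ 1)
    (hsupp : ∀ x ∉ Metric.closedBall 0 (2 * r), η x = 0)
    (hd1 : ∀ i x, |pderiv i η x| ≤ K / r)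
    (hd2 : ∀ i x, |pderiv i (pderiv i η) x| ≤ K / r ^ 2) :
    ∫ x, η x ^ 4 * lap u x ^ 2
      ≤ 4 * ((n * (12 * K ^ 2 + 4 * K)) ^ 2
          + 16 * n * (n * (30 * K ^ 2 + 6 * K) + 1) * K ^ 2) / r ^ 4 * S ^ 2
        * volume.real (Metric.closedBall (0 : EuclideanSpace ℝ (Fin n)) (2 * r)) := by
  set f := lap u with hf_def
  set M := n * (12 * K ^ 2 + 4 * K)
  set N := n * (30 * K ^ 2 + 6 * K) + 1 with hN
  have hNpos : 0 < N := by positivity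
  have hMnn : 0 ≤ M := by positivity
  have hf : ContDiff ℝ (⊤ : ℕ∞) f := contDiff_lap_s11 hu
  have hpowc : ∀ k : ℕ, HasCompactSupport fun x => η x ^ (k + 1) := fun k =>
    HasCompactSupport.intro (isCompact_closedBall 0 (2 * r)) fun x hx => by simp [hsupp x hx]
  have hlap4 : ∀ x, |lap (fun x => η x ^ 4) x| ≤ M / r ^ 2 * η x ^ 2 := fun x => by
    have := abs_lap_pow_le hη h0 h1 hd1 hd2 2 x
    norm_num at this
    exact this
  have hlap6 : ∀ x, |lap (fun x => η x ^ 6) x| ≤ N / r ^ 2 * η x ^ 4 := fun x => by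
    have := abs_lap_pow_le hη h0 h1 hd1 hd2 4 x
    norm_num at this
    refine this.trans ?_
    gcongr
    simp [hN]
  let G : EuclideanSpace ℝ (Fin n) → ℝ := fun x => ∑ i, pderiv i f x ^ 2
  have hG : ContDiff ℝ (⊤ : ℕ∞) G := ContDiff.sum fun i _ => (contDiff_pderiv hf i).pow 2
  have hInt : ∀ (k : ℕ) {a : EuclideanSpace ℝ (Fin n) → ℝ}, ContDiff ℝ (⊤ : ℕ∞) a →
      Integrable fun x => η x ^ (k + 1) * a x := fun k a ha =>
    ((hη.continuous.pow (k + 1)).mul ha.continuous).integrable_of_hasCompactSupport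
      (hpowc k).mul_right
  have hA := hInt 3 (hf.pow 2)
  have hE := hInt 5 hG
  have energy : 2 * ∫ x, η x ^ 6 * G x ≤ N / r ^ 2 * ∫ x, η x ^ 4 * f x ^ 2 := by
    have e1 : ∀ x, lap (fun x => f x ^ 2) x = 2 * G x := fun x => by
      simp only [sq]
      rw [lap_mul hf hf, hbi x]
      simp [G, sq]
    have e2 := integral_mul_lap_eq (hη.pow 6) (hf.pow 2) (hpowc 5)
    simp only [e1] at e2
    rw [← integral_const_mul, ← integral_const_mul]
    calc ∫ x, 2 * (η x ^ 6 * G x) = ∫ x, η x ^ 6 * (2 * G x) := by congr 1; ext x; ring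
      _ = ∫ x, f x ^ 2 * lap (fun x => η x ^ 6) x := e2
      _ ≤ ∫ x, N / r ^ 2 * (η x ^ 4 * f x ^ 2) := by
        refine integral_mono ?_ (hA.const_mul _) fun x => ?_
        · refine Continuous.integrable_of_hasCompactSupport
            ((hf.pow 2).continuous.mul (contDiff_lap_s11 (hη.pow 6)).continuous) ?_
          refine HasCompactSupport.intro (isCompact_closedBall 0 (2 * r)) fun x hx => ?_
          have := hlap6 x
          simp only [hsupp x hx] at this
          norm_num at this
          simp [this]
        · have := (le_abs_self _).trans (hlap6 x)
          nlinarith [sq_nonneg (f x)]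
  have formula : ∀ x, lap (fun x => η x ^ 4 * f x) x
      = f x * lap (fun x => η x ^ 4) x + ∑ i, 8 * η x ^ 3 * pderiv i η x * pderiv i f x := by
    intro x
    rw [lap_mul (hη.pow 4) hf, hbi x, mul_zero, add_zero, Finset.mul_sum]
    congr 1
    refine Finset.sum_congr rfl fun i _ => ?_
    rw [pderiv_pow hη 3 i]
    push_cast
    ring
  set Q := (M ^ 2 + 16 * n * N * K ^ 2) / r ^ 4 * S ^ 2 with hQ
  have young : ∀ x, u x * lap (fun x => η x ^ 4 * f x) x
      ≤ 1 / 4 * (η x ^ 4 * f x ^ 2) + r ^ 2 / N * (η x ^ 6 * G x)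
        + (Metric.closedBall 0 (2 * r)).indicator (fun _ => Q) x := by
    intro x
    rw [formula]
    by_cases hx : x ∈ Metric.closedBall 0 (2 * r)
    · rw [Set.indicator_of_mem hx]
      have hu2 : u x ^ 2 ≤ S ^ 2 := by
        rw [← sq_abs]
        exact pow_le_pow_left₀ (abs_nonneg _) (hS x hx) 2
      have t1 : u x * (f x * lap (fun x => η x ^ 4) x)
          ≤ 1 / 4 * (η x ^ 4 * f x ^ 2) + M ^ 2 / r ^ 4 * S ^ 2 := by
        calc u x * (f x * lap (fun x => η x ^ 4) x)
            ≤ |u x * (f x * lap (fun x => η x ^ 4) x)| := le_abs_self _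
          _ = |u x| * |f x| * |lap (fun x => η x ^ 4) x| := by rw [abs_mul, abs_mul, mul_assoc]
          _ ≤ |u x| * |f x| * (M / r ^ 2 * η x ^ 2) := by
            gcongr
            exact hlap4 x
          _ ≤ 1 / 4 * (η x ^ 4 * |f x| ^ 2) + M ^ 2 / r ^ 4 * |u x| ^ 2 := by
            have hsq : 0 ≤ (1 / 2 * (η x ^ 2 * |f x|) - M / r ^ 2 * |u x|) ^ 2 := sq_nonneg _
            have hexp : (1 / 2 * (η x ^ 2 * |f x|) - M / r ^ 2 * |u x|) ^ 2
                = 1 / 4 * (η x ^ 4 * |f x| ^ 2) + M ^ 2 / r ^ 4 * |u x| ^ 2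
                  - |u x| * |f x| * (M / r ^ 2 * η x ^ 2) := by ring
            linarith
          _ ≤ _ := by
            rw [sq_abs, sq_abs]
            gcongr
      have t2 : ∀ i, u x * (8 * η x ^ 3 * pderiv i η x * pderiv i f x)
          ≤ r ^ 2 / N * (η x ^ 6 * pderiv i f x ^ 2) + 16 * N * K ^ 2 / r ^ 4 * S ^ 2 := by
        intro i
        have hsq : 0 ≤ r ^ 2 / N
            * (η x ^ 3 * pderiv i f x - 4 * N / r ^ 2 * (pderiv i η x * u x)) ^ 2 := by positivity
        have hexp : r ^ 2 / N
            * (η x ^ 3 * pderiv i f x - 4 * N / r ^ 2 * (pderiv i η x * u x)) ^ 2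
            = r ^ 2 / N * (η x ^ 6 * pderiv i f x ^ 2)
              + 16 * N / r ^ 2 * (pderiv i η x ^ 2 * u x ^ 2)
              - u x * (8 * η x ^ 3 * pderiv i η x * pderiv i f x) := by
          field_simp
          ring
        have hη2 : pderiv i η x ^ 2 ≤ (K / r) ^ 2 := by
          rw [← sq_abs]
          exact pow_le_pow_left₀ (abs_nonneg _) (hd1 i x) 2
        have hle : 16 * N / r ^ 2 * (pderiv i η x ^ 2 * u x ^ 2)
            ≤ 16 * N / r ^ 2 * ((K / r) ^ 2 * S ^ 2) := by gcongr
        have heq : 16 * N / r ^ 2 * ((K / r) ^ 2 * S ^ 2)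
            = 16 * N * K ^ 2 / r ^ 4 * S ^ 2 := by
          field_simp
        linarith
      have t3 := Finset.sum_le_sum fun i (_ : i ∈ Finset.univ) => t2 i
      rw [Finset.sum_add_distrib, ← Finset.mul_sum, ← Finset.mul_sum, ← Finset.mul_sum,
        Finset.sum_const, Finset.card_univ, Fintype.card_fin, nsmul_eq_mul] at t3
      have hQ' : Q = M ^ 2 / r ^ 4 * S ^ 2 + n * (16 * N * K ^ 2 / r ^ 4 * S ^ 2) := by
        rw [hQ]; ring
      rw [mul_add, hQ']
      linarith
    · have hz := hsupp x hx
      have hl : lap (fun x => η x ^ 4) x = 0 := by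
        have := hlap4 x
        rw [hz] at this
        simpa using this
      rw [Set.indicator_of_notMem hx, hl, hz]
      simp
  have hind : Integrable
      ((Metric.closedBall (0 : EuclideanSpace ℝ (Fin n)) (2 * r)).indicator fun _ => Q) :=
    (integrable_indicator_iff measurableSet_closedBall).2
      (integrableOn_const (isCompact_closedBall _ _).measure_lt_top.ne)
  have hprodc : HasCompactSupport fun x => η x ^ 4 * f x := (hpowc 3).mul_right
  have hI1 : Integrable fun x => 1 / 4 * (η x ^ 4 * f x ^ 2) := hA.const_mul (1 / 4)
  have hI2 : Integrable fun x => r ^ 2 / N * (η x ^ 6 * G x) := hE.const_mul (r ^ 2 / N)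
  have hI12 : Integrable fun x =>
      1 / 4 * (η x ^ 4 * f x ^ 2) + r ^ 2 / N * (η x ^ 6 * G x) := hI1.add hI2
  have main : ∫ x, η x ^ 4 * f x ^ 2
      ≤ 1 / 4 * (∫ x, η x ^ 4 * f x ^ 2) + r ^ 2 / N * (∫ x, η x ^ 6 * G x)
        + volume.real (Metric.closedBall (0 : EuclideanSpace ℝ (Fin n)) (2 * r)) * Q := by
    calc ∫ x, η x ^ 4 * f x ^ 2 = ∫ x, η x ^ 4 * f x * lap u x := by
          congr 1; ext x; rw [hf_def]; ring
      _ = ∫ x, u x * lap (fun x => η x ^ 4 * f x) x :=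
        integral_mul_lap_eq ((hη.pow 4).mul hf) hu hprodc
      _ ≤ ∫ x, (1 / 4 * (η x ^ 4 * f x ^ 2) + r ^ 2 / N * (η x ^ 6 * G x)
            + (Metric.closedBall 0 (2 * r)).indicator (fun _ => Q) x) := by
        refine integral_mono ?_ (hI12.add hind) young
        refine Continuous.integrable_of_hasCompactSupport
          (hu.continuous.mul (contDiff_lap_s11 ((hη.pow 4).mul hf)).continuous) ?_
        refine HasCompactSupport.intro (isCompact_closedBall 0 (2 * r)) fun x hx => ?_
        have hz := hsupp x hx
        have hl : lap (fun x => η x ^ 4) x = 0 := by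
          have := hlap4 x
          rw [hz] at this
          simpa using this
        rw [formula, hl, hz]
        simp
      _ = _ := by
        rw [integral_add hI12 hind, integral_add hI1 hI2, integral_const_mul,
          integral_const_mul, integral_indicator_const _ measurableSet_closedBall, smul_eq_mul]
  have absorb : r ^ 2 / N * (∫ x, η x ^ 6 * G x) ≤ 1 / 2 * ∫ x, η x ^ 4 * f x ^ 2 := by
    have h := mul_le_mul_of_nonneg_left energy (show 0 ≤ r ^ 2 / N by positivity)
    have e : r ^ 2 / N * (N / r ^ 2 * ∫ x, η x ^ 4 * f x ^ 2) = ∫ x, η x ^ 4 * f x ^ 2 := by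
      field_simp
    linarith
  have hrearrange : 4 * (M ^ 2 + 16 * n * N * K ^ 2) / r ^ 4 * S ^ 2
      * volume.real (Metric.closedBall (0 : EuclideanSpace ℝ (Fin n)) (2 * r))
      = 4 * (volume.real (Metric.closedBall (0 : EuclideanSpace ℝ (Fin n)) (2 * r)) * Q) := by
    rw [hQ]; ring
  rw [hrearrange]
  linarith

/-- If u is biharmonic with polynomial growth of rate d, then f = Δu satisfies
∫_{B_r} f² ≤ C (1 + r^{2d+n-2}) for all r > R₀. -/
theorem laplacian_L2_growth {n : ℕ} (d B : ℝ) (hd : 0 ≤ d) (hB : 0 < B) :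
    ∃ C R₀ : ℝ, 0 < C ∧ 0 < R₀ ∧
      ∀ u : EuclideanSpace ℝ (Fin n) → ℝ, ContDiff ℝ (⊤ : ℕ∞) u →
        (∀ x, lap (lap u) x = 0) → (∀ x, |u x| ≤ B * (1 + ‖x‖ ^ d)) →
        ∀ r : ℝ, R₀ < r →
          ∫ x in Metric.ball (0 : EuclideanSpace ℝ (Fin n)) r, (lap u x) ^ 2
            ≤ C * (1 + r ^ (2 * d + n - 2)) := by
  obtain ⟨K, hK, hcut⟩ := exists_scaled_cutoff n
  set P := 4 * ((n * (12 * K ^ 2 + 4 * K)) ^ 2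
    + 16 * n * (n * (30 * K ^ 2 + 6 * K) + 1) * K ^ 2)
  set V := volume.real (Metric.ball (0 : EuclideanSpace ℝ (Fin n)) 1) with hV
  have hPnn : 0 ≤ P := by positivity
  have hVnn : 0 ≤ V := measureReal_nonneg
  set L := P * (2 * B * 2 ^ d) ^ 2 * (2 ^ n * V) with hL
  have hLnn : 0 ≤ L := by positivity
  refine ⟨L + 1, 1, by positivity, one_pos, fun u hu hbi hgrow r hr => ?_⟩
  have hr0 : 0 < r := one_pos.trans hr
  obtain ⟨η, hη, h0, h1, hone, hsupp, hd1, hd2⟩ := hcut r hr0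
  have hS : ∀ x ∈ Metric.closedBall (0 : EuclideanSpace ℝ (Fin n)) (2 * r),
      |u x| ≤ 2 * B * 2 ^ d * r ^ d := by
    intro x hx
    rw [mem_closedBall_zero_iff] at hx
    have hp : ‖x‖ ^ d ≤ (2 * r) ^ d := Real.rpow_le_rpow (norm_nonneg _) hx hd
    have hp1 : 1 ≤ (2 * r) ^ d := Real.one_le_rpow (by linarith) hd
    calc |u x| ≤ B * (1 + ‖x‖ ^ d) := hgrow x
      _ ≤ B * ((2 * r) ^ d + (2 * r) ^ d) := by gcongr
      _ = 2 * B * (2 ^ d * r ^ d) := by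
        rw [Real.mul_rpow (by norm_num) hr0.le]; ring
      _ = _ := by ring
  have est := integral_cutoff_mul_sq_lap_le hu hbi hr0 hK hS hη h0 h1 hsupp hd1 hd2
  have hvol : volume.real (Metric.closedBall (0 : EuclideanSpace ℝ (Fin n)) (2 * r))
      = 2 ^ n * r ^ n * V := by
    rw [hV, Measure.real, Measure.addHaar_closedBall _ _ (by positivity), ENNReal.toReal_mul,
      ENNReal.toReal_ofReal (by positivity), finrank_euclideanSpace_fin, mul_pow, Measure.real]
  rw [hvol] at est
  have hInt : Integrable fun x => η x ^ 4 * lap u x ^ 2 :=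
    ((hη.continuous.pow 4).mul ((contDiff_lap_s11 hu).continuous.pow 2)).integrable_of_hasCompactSupport
      (HasCompactSupport.intro (isCompact_closedBall 0 (2 * r)) fun x hx => by simp [hsupp x hx])
  have hpow : (r ^ d) ^ 2 * r ^ n / r ^ 4 ≤ r ^ (2 * d + n - 2) := by
    have e : (r ^ d) ^ 2 * r ^ n / r ^ 4 = r ^ (2 * d + n - 4) := by
      rw [Real.rpow_sub hr0, Real.rpow_add hr0, Real.rpow_natCast, mul_comm 2 d,
        Real.rpow_mul hr0.le]
      norm_cast
    rw [e]
    exact Real.rpow_le_rpow_of_exponent_le hr.le (by linarith)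
  have hrp : 0 ≤ r ^ (2 * d + n - 2) := by positivity
  calc ∫ x in Metric.ball (0 : EuclideanSpace ℝ (Fin n)) r, lap u x ^ 2
      = ∫ x in Metric.ball (0 : EuclideanSpace ℝ (Fin n)) r, η x ^ 4 * lap u x ^ 2 :=
        setIntegral_congr_fun measurableSet_ball fun x hx => by simp [hone x hx]
    _ ≤ ∫ x, η x ^ 4 * lap u x ^ 2 :=
        setIntegral_le_integral hInt (Filter.Eventually.of_forall fun x => by positivity)
    _ ≤ P / r ^ 4 * (2 * B * 2 ^ d * r ^ d) ^ 2 * (2 ^ n * r ^ n * V) := est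
    _ = L * ((r ^ d) ^ 2 * r ^ n / r ^ 4) := by rw [hL]; ring
    _ ≤ L * r ^ (2 * d + n - 2) := by gcongr
    _ ≤ (L + 1) * (1 + r ^ (2 * d + n - 2)) := by nlinarith
end
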